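/- Let 𝒳 and 𝒴 be boundedly compact pmm spaces and let d denote the Gromov-Hausdorff-Prokhorov distance on boundedly compact pmm spaces. If δ := d(𝒳,𝒴) > 0, then a_δ(𝒳,𝒴) ∨ a_δ(𝒴,𝒳) ≥ δ/2 (in particular the infimum defining d is not attained). Moreover, if d(𝒳,𝒴) < γ ≤ 1, then a_γ(𝒳,𝒴) ∨ a_γ(𝒴,𝒳) < γ/2. -/

import Mathlib

open MeasureTheory Topology Filter

noncomputable section

/-- Prokhorov distance between finite Borel measures on a metric space. -/
def prokhorovDist {Z : Type*} [MetricSpace Z] [MeasurableSpace Z]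
    (μ ν : Measure Z) : ℝ :=
  sInf {ε : ℝ | 0 < ε ∧ ∀ A : Set Z, IsClosed A →
    μ A ≤ ν (Metric.cthickening ε A) + ENNReal.ofReal ε ∧
    ν A ≤ μ (Metric.cthickening ε A) + ENNReal.ofReal ε}

/-- A pointed measured metric space: a metric space with a distinguished point and a Borel
measure. -/
structure PMM : Type 1 where
  carrier : Type
  metric : MetricSpace carrier
  basepoint : carrier
  meas : @Measure carrier
    (@borel carrier metric.toPseudoMetricSpace.toUniformSpace.toTopologicalSpace)

attribute [instance] PMM.metric

instance PMM.instMeasurableSpace (𝒳 : PMM) : MeasurableSpace 𝒳.carrier := borel 𝒳.carrier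

instance PMM.instBorelSpace (𝒳 : PMM) : BorelSpace 𝒳.carrier := ⟨rfl⟩

/-- A pmm space is boundedly compact if every closed ball is compact and has finite measure. -/
def PMM.BoundedlyCompact (𝒳 : PMM) : Prop :=
  (∀ (x : 𝒳.carrier) (r : ℝ), IsCompact (Metric.closedBall x r)) ∧
  (∀ (x : 𝒳.carrier) (r : ℝ), 𝒳.meas (Metric.closedBall x r) ≠ ⊤)

/-- A pmm space is compact if its carrier is compact and its measure is finite. -/
def PMM.IsCompactPMM (𝒳 : PMM) : Prop :=
  CompactSpace 𝒳.carrier ∧ 𝒳.meas Set.univ ≠ ⊤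

/-- A pair of maps of two pmm spaces into a common metric space. -/
structure GHPEmbedding (𝒳 𝒴 : PMM) : Type 1 where
  Z : Type
  mZ : MetricSpace Z
  f : 𝒳.carrier → Z
  g : 𝒴.carrier → Z

attribute [instance] GHPEmbedding.mZ

/-- Both maps of a `GHPEmbedding` are isometric embeddings. -/
def GHPEmbedding.IsIsometric {𝒳 𝒴 : PMM} (e : GHPEmbedding 𝒳 𝒴) : Prop :=
  Isometry e.f ∧ Isometry e.g

/-- The quantity `max(d(f o_X, g o_Y), dH(f(X), g(Y)), dP(f_*μ_X, g_*μ_Y))` associated to a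
pair of embeddings into a common space. -/
def GHPEmbedding.value {𝒳 𝒴 : PMM} (e : GHPEmbedding 𝒳 𝒴) : ℝ :=
  letI : MeasurableSpace e.Z := borel e.Z
  max (dist (e.f 𝒳.basepoint) (e.g 𝒴.basepoint))
    (max (Metric.hausdorffDist (Set.range e.f) (Set.range e.g))
      (prokhorovDist (𝒳.meas.map e.f) (𝒴.meas.map e.g)))

/-- The Gromov-Hausdorff-Prokhorov distance of compact pmm spaces. -/
def cGHP (𝒳 𝒴 : PMM) : ℝ :=
  sInf {x : ℝ | ∃ e : GHPEmbedding 𝒳 𝒴, e.IsIsometric ∧ x = e.value}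

/-- A pmm-subspace of a pmm space `𝒳`: a subset containing the basepoint together with a
measure `≤ 𝒳.meas` supported on the subset. -/
structure SubPMM (𝒳 : PMM) where
  set : Set 𝒳.carrier
  root_mem : 𝒳.basepoint ∈ set
  meas : Measure 𝒳.carrier
  meas_le : meas ≤ 𝒳.meas
  supported : meas setᶜ = 0

/-- The pmm space associated to a pmm-subspace. -/
def SubPMM.toPMM {𝒳 : PMM} (S : SubPMM 𝒳) : PMM where
  carrier := ↥S.set
  metric := inferInstance
  basepoint := ⟨𝒳.basepoint, S.root_mem⟩
  meas := @Measure.comap ↥S.set 𝒳.carrier (borel ↥S.set) inferInstance Subtype.val S.meas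

/-- The pmm-subspace ordering: inclusion of sets and inequality of measures. -/
instance {𝒳 : PMM} : LE (SubPMM 𝒳) :=
  ⟨fun S T => S.set ⊆ T.set ∧ S.meas ≤ T.meas⟩

/-- Compactness of a pmm-subspace. -/
def SubPMM.IsCompactSub {𝒳 : PMM} (S : SubPMM 𝒳) : Prop :=
  IsCompact S.set ∧ S.meas Set.univ ≠ ⊤

/-- The closed ball of radius `r` around the basepoint, as a pmm-subspace (for `r ≥ 0` the
underlying set is exactly the closed ball; the basepoint is inserted so that the definition
makes sense for all `r`). -/
def PMM.ballSub (𝒳 : PMM) (r : ℝ) : SubPMM 𝒳 where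
  set := insert 𝒳.basepoint (Metric.closedBall 𝒳.basepoint r)
  root_mem := Set.mem_insert _ _
  meas := 𝒳.meas.restrict (insert 𝒳.basepoint (Metric.closedBall 𝒳.basepoint r))
  meas_le := Measure.restrict_le_self
  supported := by
    rw [Measure.restrict_apply ((measurableSet_closedBall.insert 𝒳.basepoint).compl),
      Set.compl_inter_self]
    simp

/-- The quantity `a(ε, r; 𝒳, 𝒴)`. -/
def aFun (ε r : ℝ) (𝒳 𝒴 : PMM) : ℝ :=
  sInf {x : ℝ | ∃ Y' : SubPMM 𝒴, Y'.IsCompactSub ∧ 𝒴.ballSub (r - ε) ≤ Y' ∧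
    x = cGHP ((𝒳.ballSub r).toPMM) Y'.toPMM}

/-- The quantity `a_ε(𝒳, 𝒴) = a(ε, 1/ε; 𝒳, 𝒴)`. -/
def aEps (ε : ℝ) (𝒳 𝒴 : PMM) : ℝ := aFun ε (1 / ε) 𝒳 𝒴

/-- The Gromov-Hausdorff-Prokhorov distance of boundedly compact pmm spaces
(with `inf ∅ = 1`). -/
def GHP (𝒳 𝒴 : PMM) : ℝ :=
  sInf (insert 1 {ε : ℝ | ε ∈ Set.Ioc (0 : ℝ) 1 ∧ max (aEps ε 𝒳 𝒴) (aEps ε 𝒴 𝒳) < ε / 2})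

/-- Two pmm spaces are GHP-isometric if there is a root-preserving measure-preserving
surjective isometry between them. -/
def GHPIsometric (𝒳 𝒴 : PMM) : Prop :=
  ∃ ρ : 𝒳.carrier → 𝒴.carrier, Isometry ρ ∧ Function.Surjective ρ ∧
    ρ 𝒳.basepoint = 𝒴.basepoint ∧ 𝒳.meas.map ρ = 𝒴.meas

/-- `r` is a continuity radius of a pmm space. -/
def PMM.ContinuityRadius (𝒳 : PMM) (r : ℝ) : Prop :=
  0 < r ∧ Metric.closedBall 𝒳.basepoint r = closure (Metric.ball 𝒳.basepoint r) ∧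
    𝒳.meas (Metric.closedBall 𝒳.basepoint r \ Metric.ball 𝒳.basepoint r) = 0


open Classical in
lemma hall_nat {I J : Type} [Fintype I] [Fintype J] (m : I → ℕ) (n : J → ℕ) (R : I → J → Prop)
    (h : ∀ S : Finset I, ∑ i ∈ S, m i ≤ ∑ j ∈ Finset.univ.filter (fun j => ∃ i ∈ S, R i j), n j) :
    ∃ π : I → J → ℕ, (∀ i j, π i j ≠ 0 → R i j) ∧ (∀ i, ∑ j, π i j = m i) ∧
      ∀ j, ∑ i, π i j ≤ n j := by
  have key : ∃ f : (Σ i, Fin (m i)) → (Σ j, Fin (n j)), Function.Injective f ∧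
      ∀ x, R x.1 (f x).1 := by
    refine (Fintype.all_card_le_filter_rel_iff_exists_injective
      (fun (a : Σ i, Fin (m i)) (b : Σ j, Fin (n j)) => R a.1 b.1)).1 ?_
    intro A
    calc A.card ≤ ((A.image Sigma.fst).sigma (fun i => (Finset.univ : Finset (Fin (m i))))).card := by
          apply Finset.card_le_card
          intro a ha
          simp only [Finset.mem_sigma, Finset.mem_univ, and_true]
          exact Finset.mem_image_of_mem _ ha
      _ = ∑ i ∈ A.image Sigma.fst, m i := by simp [Finset.card_sigma]
      _ ≤ _ := h _
      _ = ((Finset.univ.filter (fun j => ∃ i ∈ A.image Sigma.fst, R i j)).sigma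
            (fun j => (Finset.univ : Finset (Fin (n j))))).card := by simp [Finset.card_sigma]
      _ ≤ _ := by
          apply Finset.card_le_card
          intro b hb
          simp only [Finset.mem_sigma, Finset.mem_univ, and_true, Finset.mem_filter, true_and,
            Finset.mem_image] at hb ⊢
          obtain ⟨i, ⟨a, ha, rfl⟩, hR⟩ := hb
          exact ⟨a, ha, hR⟩
  obtain ⟨f, hf, hR⟩ := key
  refine ⟨fun i j => (Finset.univ.filter (fun k : Fin (m i) => (f ⟨i, k⟩).1 = j)).card, ?_, ?_, ?_⟩
  · intro i j hij
    obtain ⟨k, hk⟩ := Finset.card_pos.1 (Nat.pos_of_ne_zero hij)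
    have h1 := hR ⟨i, k⟩
    simp only [Finset.mem_filter, Finset.mem_univ, true_and] at hk
    rwa [hk] at h1
  · intro i
    have := Finset.card_eq_sum_card_fiberwise (s := (Finset.univ : Finset (Fin (m i))))
      (t := (Finset.univ : Finset J)) (f := fun k => (f ⟨i, k⟩).1) (by simp)
    simpa using this.symm
  · intro j
    calc ∑ i, (Finset.univ.filter (fun k : Fin (m i) => (f ⟨i, k⟩).1 = j)).card
        = ((Finset.univ : Finset I).sigma
            (fun i => Finset.univ.filter (fun k : Fin (m i) => (f ⟨i, k⟩).1 = j))).card := by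
          rw [Finset.card_sigma]
      _ ≤ (({j} : Finset J).sigma (fun j => (Finset.univ : Finset (Fin (n j))))).card := by
          apply Finset.card_le_card_of_injOn f
          · intro a ha
            simp at ha ⊢
            exact ha
          · exact hf.injOn
      _ = n j := by simp [Finset.card_sigma]

open Classical in
lemma hall_real {I J : Type} [Fintype I] [Fintype J] (m : I → ℝ) (n : J → ℝ) (R : I → J → Prop)
    (hm : ∀ i, 0 ≤ m i) (hn : ∀ j, 0 ≤ n j)
    (h : ∀ S : Finset I, ∑ i ∈ S, m i ≤ ∑ j ∈ Finset.univ.filter (fun j => ∃ i ∈ S, R i j), n j) :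
    ∃ π : I → J → ℝ, (∀ i j, 0 ≤ π i j) ∧ (∀ i j, π i j ≠ 0 → R i j) ∧ (∀ i, ∑ j, π i j = m i) ∧
      ∀ j, ∑ i, π i j ≤ n j := by
  have step : ∀ N : ℕ, ∃ π : I → J → ℝ, (∀ i j, 0 ≤ π i j) ∧ (∀ i j, ¬ R i j → π i j = 0) ∧
      (∀ i, ∑ j, π i j ≤ m i ∧ m i ≤ ∑ j, π i j + 1 / ((N : ℝ) + 1)) ∧
      ∀ j, ∑ i, π i j ≤ n j + 1 / ((N : ℝ) + 1) := by
    intro N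
    have hN : (0 : ℝ) < (N : ℝ) + 1 := by positivity
    obtain ⟨p, hp1, hp2, hp3⟩ := hall_nat (fun i => ⌊((N : ℝ) + 1) * m i⌋₊)
      (fun j => ⌈((N : ℝ) + 1) * n j⌉₊) R (by
        intro S
        have h1 : ((∑ i ∈ S, ⌊((N : ℝ) + 1) * m i⌋₊ : ℕ) : ℝ) ≤ ((N : ℝ) + 1) * ∑ i ∈ S, m i := by
          push_cast
          rw [Finset.mul_sum]
          exact Finset.sum_le_sum fun i _ => Nat.floor_le (mul_nonneg hN.le (hm i))
        have h2 : ((N : ℝ) + 1) * ∑ j ∈ Finset.univ.filter (fun j => ∃ i ∈ S, R i j), n j ≤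
            ((∑ j ∈ Finset.univ.filter (fun j => ∃ i ∈ S, R i j), ⌈((N : ℝ) + 1) * n j⌉₊ : ℕ) : ℝ) := by
          push_cast
          rw [Finset.mul_sum]
          exact Finset.sum_le_sum fun i _ => Nat.le_ceil _
        exact_mod_cast h1.trans ((mul_le_mul_of_nonneg_left (h S) hN.le).trans h2))
    refine ⟨fun i j => (p i j : ℝ) / ((N : ℝ) + 1), fun i j => by positivity, ?_, ?_, ?_⟩
    · intro i j hij
      have : p i j = 0 := by
        by_contra hc
        exact hij (hp1 i j hc)
      simp [this]
    · intro i
      rw [← Finset.sum_div]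
      have e : (∑ j, (p i j : ℝ)) = (⌊((N : ℝ) + 1) * m i⌋₊ : ℝ) := by exact_mod_cast hp2 i
      rw [e, ← add_div]
      refine ⟨?_, ?_⟩
      · rw [div_le_iff₀ hN]
        have := Nat.floor_le (mul_nonneg hN.le (hm i))
        linarith
      · rw [le_div_iff₀ hN, mul_comm]
        exact (Nat.lt_floor_add_one _).le
    · intro j
      rw [← Finset.sum_div]
      have e : (∑ i, (p i j : ℝ)) ≤ (⌈((N : ℝ) + 1) * n j⌉₊ : ℝ) := by exact_mod_cast hp3 j
      rw [div_le_iff₀ hN, add_mul, one_div, inv_mul_cancel₀ hN.ne', mul_comm]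
      exact e.trans (Nat.ceil_lt_add_one (mul_nonneg hN.le (hn j))).le
  choose p hp0 hpR hpr hpc using step
  have hK : IsCompact (Set.univ.pi fun i : I => Set.univ.pi fun _ : J => Set.Icc (0 : ℝ) (m i)) :=
    isCompact_univ_pi fun i => isCompact_univ_pi fun _ => isCompact_Icc
  obtain ⟨π, hπ, φ, hφ, hlim⟩ := hK.tendsto_subseq (x := p) (by
    intro N i _ j _
    exact ⟨hp0 N i j, (Finset.single_le_sum (fun j _ => hp0 N i j) (Finset.mem_univ j)).trans
      (hpr N i).1⟩)
  have hl : ∀ i j, Tendsto (fun N => p (φ N) i j) atTop (𝓝 (π i j)) := by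
    intro i j
    exact tendsto_pi_nhds.1 (tendsto_pi_nhds.1 hlim i) j
  have h0 : Tendsto (fun N => 1 / (((φ N : ℕ) : ℝ) + 1)) atTop (𝓝 0) :=
    tendsto_one_div_add_atTop_nhds_zero_nat.comp hφ.tendsto_atTop
  have hrow : ∀ i, Tendsto (fun N => ∑ j, p (φ N) i j) atTop (𝓝 (∑ j, π i j)) := fun i =>
    tendsto_finsetSum _ fun j _ => hl i j
  have hcol : ∀ j, Tendsto (fun N => ∑ i, p (φ N) i j) atTop (𝓝 (∑ i, π i j)) := fun j =>
    tendsto_finsetSum _ fun i _ => hl i j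
  refine ⟨π, fun i j => (hπ i trivial j trivial).1, ?_, ?_, ?_⟩
  · intro i j hij
    by_contra hc
    apply hij
    refine tendsto_nhds_unique (hl i j) ?_
    simp [hpR _ i j hc]
  · intro i
    apply le_antisymm
    · exact le_of_tendsto (hrow i) (Eventually.of_forall fun N => (hpr _ i).1)
    · have := (hrow i).add h0
      rw [add_zero] at this
      exact ge_of_tendsto this (Eventually.of_forall fun N => (hpr _ i).2)
  · intro j
    have := (tendsto_const_nhds (x := n j)).add h0
    rw [add_zero] at this
    exact le_of_tendsto_of_tendsto (hcol j) this (Eventually.of_forall fun N => hpc _ j)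

open Classical in
lemma hall_deficit_aux {I J : Type} [Fintype I] [Fintype J] (m : I → ℝ) (n : J → ℝ)
    (R : I → J → Prop) (η : ℝ) (hη : 0 ≤ η)
    (hm : ∀ i, 0 ≤ m i) (hn : ∀ j, 0 ≤ n j)
    (h : ∀ S : Finset I, ∑ i ∈ S, m i ≤
      ∑ j ∈ Finset.univ.filter (fun j => ∃ i ∈ S, R i j), n j + η) :
    ∃ π : I → J → ℝ, (∀ i j, 0 ≤ π i j) ∧ (∀ i j, π i j ≠ 0 → R i j) ∧ (∀ i, ∑ j, π i j ≤ m i) ∧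
      (∀ j, ∑ i, π i j ≤ n j) ∧ ∑ i, m i - η ≤ ∑ i, ∑ j, π i j := by
  obtain ⟨p, hp0, hpR, hpr, hpc⟩ := hall_real m (fun o : Option J => o.elim η n)
    (fun i o => ∀ j, o = some j → R i j) hm (by rintro (_ | j); exacts [hη, hn j]) (by
      intro S
      rw [Finset.sum_filter, Fintype.sum_option]
      by_cases hS : S = ∅
      · subst hS; simp
      · obtain ⟨i, hi⟩ := Finset.nonempty_iff_ne_empty.2 hS
        have := h S
        rw [Finset.sum_filter] at this
        rw [if_pos ⟨i, hi, by simp⟩]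
        simpa [add_comm] using this)
  refine ⟨fun i j => p i (some j), fun i j => hp0 _ _, fun i j hij => hpR _ _ hij j rfl, ?_,
    fun j => hpc (some j), ?_⟩
  · intro i
    rw [← hpr i, Fintype.sum_option]
    linarith [hp0 i none]
  · have h1 := hpc none
    simp only [Option.elim] at h1
    have h2 : ∑ i, m i = ∑ i, p i none + ∑ i, ∑ j, p i (some j) := by
      rw [← Finset.sum_add_distrib]
      refine Finset.sum_congr rfl fun i _ => ?_
      rw [← hpr i, Fintype.sum_option]
    linarith

open Classical in
lemma hall_deficit {I J : Type} [Fintype I] [Fintype J] (m : I → ℝ) (n : J → ℝ)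
    (R : I → J → Prop) (η : ℝ) (hη : 0 ≤ η)
    (hm : ∀ i, 0 ≤ m i) (hn : ∀ j, 0 ≤ n j)
    (h : ∀ S : Finset I, ∑ i ∈ S, m i ≤
      ∑ j ∈ Finset.univ.filter (fun j => ∃ i ∈ S, R i j), n j + η)
    (h' : ∀ S : Finset J, ∑ j ∈ S, n j ≤
      ∑ i ∈ Finset.univ.filter (fun i => ∃ j ∈ S, R i j), m i + η) :
    ∃ π : I → J → ℝ, (∀ i j, 0 ≤ π i j) ∧ (∀ i j, π i j ≠ 0 → R i j) ∧ (∀ i, ∑ j, π i j ≤ m i) ∧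
      (∀ j, ∑ i, π i j ≤ n j) ∧ ∑ i, m i - η ≤ ∑ i, ∑ j, π i j ∧
      ∑ j, n j - η ≤ ∑ j, ∑ i, π i j := by
  rcases le_total (∑ i, m i) (∑ j, n j) with hle | hle
  · obtain ⟨p, h0, hR, hr, hc, ht⟩ := hall_deficit_aux n m (fun j i => R i j) η hη hn hm h'
    refine ⟨fun i j => p j i, fun i j => h0 _ _, fun i j => hR _ _, hc, hr, ?_, ht⟩
    rw [Finset.sum_comm]
    linarith
  · obtain ⟨p, h0, hR, hr, hc, ht⟩ := hall_deficit_aux m n R η hη hm hn h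
    refine ⟨p, h0, hR, hr, hc, ht, ?_⟩
    rw [Finset.sum_comm]
    linarith
/-- Closeness of two pmm-subspaces inside a common space. -/
def CloseIn {Z : Type} [MetricSpace Z] {𝒳 𝒴 : PMM} (F : 𝒳.carrier → Z) (G : 𝒴.carrier → Z)
    (η : ℝ) (S : SubPMM 𝒳) (T : SubPMM 𝒴) : Prop :=
  0 < η ∧ dist (F 𝒳.basepoint) (G 𝒴.basepoint) ≤ η ∧
  (∀ x ∈ S.set, ∃ y ∈ T.set, dist (F x) (G y) ≤ η) ∧
  (∀ y ∈ T.set, ∃ x ∈ S.set, dist (F x) (G y) ≤ η) ∧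
  ∀ A : Set Z, IsClosed A →
    S.meas (F ⁻¹' A) ≤ T.meas (G ⁻¹' Metric.cthickening η A) + ENNReal.ofReal η ∧
    T.meas (G ⁻¹' A) ≤ S.meas (F ⁻¹' Metric.cthickening η A) + ENNReal.ofReal η

/-- Closeness of two pmm-subspaces. -/
def Close {𝒳 𝒴 : PMM} (η : ℝ) (S : SubPMM 𝒳) (T : SubPMM 𝒴) : Prop :=
  ∃ (Z : Type) (_ : MetricSpace Z) (F : 𝒳.carrier → Z) (G : 𝒴.carrier → Z),
    Isometry F ∧ Isometry G ∧ CloseIn F G η S T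

lemma measure_le_of_inter {X : Type} [MeasurableSpace X] {μ : Measure X} {S A B : Set X}
    (hS : μ Sᶜ = 0) (h : A ∩ S ⊆ B) : μ A ≤ μ B := by
  refine measure_mono_ae ?_
  have : ∀ᵐ x ∂μ, x ∈ S := by rw [ae_iff]; exact hS
  filter_upwards [this] with x hx hA
  exact h ⟨hA, hx⟩

lemma toPMM_meas_apply {𝒳 : PMM} (S : SubPMM 𝒳) (hS : MeasurableSet S.set) (A : Set 𝒳.carrier)
    (hA : MeasurableSet A) :
    S.toPMM.meas ((Subtype.val : S.set → 𝒳.carrier) ⁻¹' A) = S.meas A := by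
  have hb : borel ↥S.set = (inferInstance : MeasurableSpace ↥S.set) :=
    (BorelSpace.measurable_eq (α := ↥S.set)).symm
  have gen : ∀ ms : MeasurableSpace ↥S.set, ms = Subtype.instMeasurableSpace →
      (@Measure.comap ↥S.set 𝒳.carrier ms inferInstance Subtype.val S.meas)
        ((Subtype.val : S.set → 𝒳.carrier) ⁻¹' A) = S.meas A := by
    rintro _ rfl
    rw [comap_subtype_coe_apply hS, Subtype.image_preimage_coe, Set.inter_comm]
    exact le_antisymm (measure_mono Set.inter_subset_left)
      (measure_le_of_inter S.supported fun x hx => hx)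
  exact gen _ hb

lemma map_meas_apply {𝒳 : PMM} (S : SubPMM 𝒳) (hS : MeasurableSet S.set) {Z : Type}
    [MetricSpace Z] [MeasurableSpace Z] [BorelSpace Z] (f : S.toPMM.carrier → Z) (hf : Isometry f)
    (A : Set Z) (hA : IsClosed A) (B : Set 𝒳.carrier) (hB : MeasurableSet B)
    (hAB : f ⁻¹' A = (Subtype.val : S.set → 𝒳.carrier) ⁻¹' B) :
    (S.toPMM.meas.map f) A = S.meas B := by
  rw [Measure.map_apply hf.continuous.measurable hA.measurableSet, hAB]
  exact toPMM_meas_apply S hS B hB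

lemma cGHP_le_of_close {𝒳 𝒴 : PMM} {η : ℝ} {S : SubPMM 𝒳} {T : SubPMM 𝒴}
    (hS : MeasurableSet S.set) (hT : MeasurableSet T.set)
    (h : Close η S T) : cGHP S.toPMM T.toPMM ≤ η := by
  obtain ⟨Z, mZ, F, G, hF, hG, h0, ho, hst, hts, hm⟩ := h
  let e : GHPEmbedding S.toPMM T.toPMM :=
    ⟨Z, mZ, fun x => F x.1, fun y => G y.1⟩
  have he : e.IsIsometric := ⟨hF.comp isometry_subtype_coe, hG.comp isometry_subtype_coe⟩
  have hval : e.value ≤ η := by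
    unfold GHPEmbedding.value
    refine max_le ho (max_le ?_ ?_)
    · refine Metric.hausdorffDist_le_of_mem_dist h0.le ?_ ?_
      · rintro _ ⟨x, rfl⟩
        obtain ⟨y, hy, hd⟩ := hst x.1 x.2
        exact ⟨_, ⟨⟨y, hy⟩, rfl⟩, hd⟩
      · rintro _ ⟨y, rfl⟩
        obtain ⟨x, hx, hd⟩ := hts y.1 y.2
        exact ⟨_, ⟨⟨x, hx⟩, rfl⟩, by rw [dist_comm]; exact hd⟩
    · let : MeasurableSpace e.Z := borel e.Z
      have : BorelSpace e.Z := ⟨rfl⟩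
      refine csInf_le ⟨0, fun x hx => hx.1.le⟩ ⟨h0, ?_⟩
      intro A hA
      have hc : IsClosed (Metric.cthickening η A) := Metric.isClosed_cthickening
      have e1 : ∀ A : Set e.Z, IsClosed A → (S.toPMM.meas.map e.f) A = S.meas (F ⁻¹' A) :=
        fun A hA => map_meas_apply S hS _ he.1 A hA _
          (hA.preimage hF.continuous).measurableSet rfl
      have e2 : ∀ A : Set e.Z, IsClosed A → (T.toPMM.meas.map e.g) A = T.meas (G ⁻¹' A) :=
        fun A hA => map_meas_apply T hT _ he.2 A hA _
          (hA.preimage hG.continuous).measurableSet rfl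
      rw [e1 _ hA, e1 _ hc, e2 _ hA, e2 _ hc]
      exact hm A hA
  have hbdd : BddBelow {x : ℝ | ∃ e : GHPEmbedding S.toPMM T.toPMM, e.IsIsometric ∧ x = e.value} := by
    refine ⟨0, ?_⟩
    rintro x ⟨e, -, rfl⟩
    exact le_max_of_le_left dist_nonneg
  exact (csInf_le hbdd ⟨e, he, rfl⟩).trans hval

lemma exists_embedding (𝒳 𝒴 : PMM) : ∃ e : GHPEmbedding 𝒳 𝒴, e.IsIsometric := by
  have h1 : Isometry (fun _ : Unit => 𝒳.basepoint) := isometry_subsingleton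
  have h2 : Isometry (fun _ : Unit => 𝒴.basepoint) := isometry_subsingleton
  exact ⟨⟨Metric.GlueSpace h1 h2, inferInstance, Metric.toGlueL h1 h2, Metric.toGlueR h1 h2⟩,
    Metric.toGlueL_isometry h1 h2, Metric.toGlueR_isometry h1 h2⟩

lemma close_of_cGHP_lt {𝒳 𝒴 : PMM} {c : ℝ} {S : SubPMM 𝒳} {T : SubPMM 𝒴}
    (hS : S.IsCompactSub) (hT : T.IsCompactSub)
    (h : cGHP S.toPMM T.toPMM < c) : ∃ η < c, Close η S T := by
  have hSm := hS.1.measurableSet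
  have hTm := hT.1.measurableSet
  obtain ⟨_, ⟨e, he, rfl⟩, hlt⟩ := exists_lt_of_csInf_lt (by
    obtain ⟨e, he⟩ := exists_embedding S.toPMM T.toPMM
    exact ⟨_, e, he, rfl⟩) h
  let : MeasurableSpace e.Z := borel e.Z
  have : BorelSpace e.Z := ⟨rfl⟩
  unfold GHPEmbedding.value at hlt
  obtain ⟨h1, h2⟩ := max_lt_iff.1 hlt
  obtain ⟨h2, h3⟩ := max_lt_iff.1 h2
  have : CompactSpace S.toPMM.carrier := isCompact_iff_compactSpace.1 hS.1
  have : CompactSpace T.toPMM.carrier := isCompact_iff_compactSpace.1 hT.1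
  have hfin : Metric.hausdorffEDist (Set.range e.f) (Set.range e.g) ≠ ⊤ :=
    Metric.hausdorffEDist_ne_top_of_nonempty_of_bounded ⟨_, S.toPMM.basepoint, rfl⟩
      ⟨_, T.toPMM.basepoint, rfl⟩ (isCompact_range he.1.continuous).isBounded
      (isCompact_range he.2.continuous).isBounded
  have e1 : ∀ A : Set e.Z, IsClosed A → (S.toPMM.meas.map e.f) A ≤ S.meas Set.univ :=
    fun A hA => by
      rw [← map_meas_apply S hSm e.f he.1 Set.univ isClosed_univ Set.univ MeasurableSet.univ rfl]
      exact measure_mono (Set.subset_univ _)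
  have e2 : ∀ A : Set e.Z, IsClosed A → (T.toPMM.meas.map e.g) A ≤ T.meas Set.univ :=
    fun A hA => by
      rw [← map_meas_apply T hTm e.g he.2 Set.univ isClosed_univ Set.univ MeasurableSet.univ rfl]
      exact measure_mono (Set.subset_univ _)
  obtain ⟨ε, ⟨hε0, hε⟩, hεc⟩ := exists_lt_of_csInf_lt (by
    refine ⟨(S.meas Set.univ).toReal + (T.meas Set.univ).toReal + 1, by positivity, ?_⟩
    intro A hA
    have h1 : S.meas Set.univ ≤
        ENNReal.ofReal ((S.meas Set.univ).toReal + (T.meas Set.univ).toReal + 1) := by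
      rw [ENNReal.le_ofReal_iff_toReal_le hS.2 (by positivity)]
      linarith [ENNReal.toReal_nonneg (a := T.meas Set.univ)]
    have h2 : T.meas Set.univ ≤
        ENNReal.ofReal ((S.meas Set.univ).toReal + (T.meas Set.univ).toReal + 1) := by
      rw [ENNReal.le_ofReal_iff_toReal_le hT.2 (by positivity)]
      linarith [ENNReal.toReal_nonneg (a := S.meas Set.univ)]
    exact ⟨((e1 A hA).trans h1).trans le_add_self, ((e2 A hA).trans h2).trans le_add_self⟩) h3
  obtain ⟨η, hη, hηc⟩ := exists_between (max_lt hεc (max_lt h1 h2))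
  obtain ⟨g1, g2⟩ := max_lt_iff.1 hη
  obtain ⟨g2, g3⟩ := max_lt_iff.1 g2
  refine ⟨η, hηc, ?_⟩
  -- gluing
  have : Nonempty S.toPMM.carrier := ⟨S.toPMM.basepoint⟩
  have : Nonempty T.toPMM.carrier := ⟨T.toPMM.basepoint⟩
  let vS : S.toPMM.carrier → 𝒳.carrier := fun x => Subtype.val (p := fun x => x ∈ S.set) x
  let vT : T.toPMM.carrier → 𝒴.carrier := fun x => Subtype.val (p := fun x => x ∈ T.set) x
  have hvS : Isometry vS := isometry_subtype_coe
  have hvT : Isometry vT := isometry_subtype_coe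
  let L1 := Metric.toGlueL he.1 hvS
  let R1 := Metric.toGlueR he.1 hvS
  have hL1 : Isometry L1 := Metric.toGlueL_isometry he.1 hvS
  have hR1 : Isometry R1 := Metric.toGlueR_isometry he.1 hvS
  have c1 : L1 ∘ e.f = R1 ∘ vS := Metric.toGlue_commute he.1 hvS
  have hk : Isometry (L1 ∘ e.g) := hL1.comp he.2
  let L2 := Metric.toGlueL hk hvT
  let R2 := Metric.toGlueR hk hvT
  have hL2 : Isometry L2 := Metric.toGlueL_isometry hk hvT
  have hR2 : Isometry R2 := Metric.toGlueR_isometry hk hvT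
  have c2 : L2 ∘ (L1 ∘ e.g) = R2 ∘ vT := Metric.toGlue_commute hk hvT
  have hH : Isometry (L2 ∘ L1) := hL2.comp hL1
  have d1 : ∀ x (hx : x ∈ S.set), (L2 ∘ R1) x = (L2 ∘ L1) (e.f ⟨x, hx⟩) := fun x hx =>
    (congrArg L2 (congrFun c1 ⟨x, hx⟩)).symm
  have d2 : ∀ y (hy : y ∈ T.set), R2 y = (L2 ∘ L1) (e.g ⟨y, hy⟩) := fun y hy =>
    (congrFun c2 ⟨y, hy⟩).symm
  have hF : Isometry (L2 ∘ R1) := hL2.comp hR1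
  have m1 : ∀ A, IsClosed A →
      S.meas ((L2 ∘ R1) ⁻¹' A) = (S.toPMM.meas.map e.f) ((L2 ∘ L1) ⁻¹' A) := fun A hA => by
    refine (map_meas_apply S hSm e.f he.1 _ (hA.preimage hH.continuous) _
      (hA.preimage hF.continuous).measurableSet ?_).symm
    ext x
    change (L2 ∘ L1) (e.f x) ∈ A ↔ (L2 ∘ R1) x.1 ∈ A
    rw [d1 x.1 x.2]
    exact Iff.rfl
  have m2 : ∀ A, IsClosed A →
      T.meas (R2 ⁻¹' A) = (T.toPMM.meas.map e.g) ((L2 ∘ L1) ⁻¹' A) := fun A hA => by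
    refine (map_meas_apply T hTm e.g he.2 _ (hA.preimage hH.continuous) _
      (hA.preimage hR2.continuous).measurableSet ?_).symm
    ext x
    change (L2 ∘ L1) (e.g x) ∈ A ↔ R2 x.1 ∈ A
    rw [d2 x.1 x.2]
    exact Iff.rfl
  have hsub : ∀ A, Metric.cthickening ε ((L2 ∘ L1) ⁻¹' A) ⊆
      (L2 ∘ L1) ⁻¹' (Metric.cthickening η A) := by
    intro A z hz
    rw [Set.mem_preimage, Metric.mem_cthickening_iff]
    rw [Metric.mem_cthickening_iff] at hz
    calc _ ≤ Metric.infEDist ((L2 ∘ L1) z) ((L2 ∘ L1) '' ((L2 ∘ L1) ⁻¹' A)) :=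
          Metric.infEDist_anti (Set.image_preimage_subset _ _)
      _ = _ := Metric.infEDist_image hH
      _ ≤ _ := hz
      _ ≤ _ := ENNReal.ofReal_le_ofReal g1.le
  refine ⟨_, inferInstance, L2 ∘ R1, R2, hF, hR2, hε0.trans g1, ?_, ?_, ?_, ?_⟩
  · rw [d1 _ S.root_mem, d2 _ T.root_mem, hH.dist_eq]
    exact g2.le
  · intro x hx
    obtain ⟨_, ⟨y, rfl⟩, hy⟩ := Metric.exists_dist_lt_of_hausdorffDist_lt
      (Set.mem_range_self (f := e.f) (⟨x, hx⟩ : S.set)) g3 hfin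
    refine ⟨y.1, y.2, ?_⟩
    rw [d1 x hx, d2 y.1 y.2, hH.dist_eq]
    exact hy.le
  · intro y hy
    obtain ⟨_, ⟨x, rfl⟩, hx⟩ := Metric.exists_dist_lt_of_hausdorffDist_lt'
      (Set.mem_range_self (f := e.g) (⟨y, hy⟩ : T.set)) g3 hfin
    refine ⟨x.1, x.2, ?_⟩
    rw [d1 x.1 x.2, d2 y hy, hH.dist_eq]
    exact hx.le
  · intro A hA
    have hc : IsClosed (Metric.cthickening η A) := Metric.isClosed_cthickening
    obtain ⟨q1, q2⟩ := hε _ (hA.preimage hH.continuous)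
    rw [m1 _ hA, m1 _ hc, m2 _ hA, m2 _ hc]
    have hle := ENNReal.ofReal_le_ofReal g1.le
    exact ⟨q1.trans (add_le_add (measure_mono (hsub A)) hle),
      q2.trans (add_le_add (measure_mono (hsub A)) hle)⟩

/-- A finite measurable partition into small cells, compatible with a given set. -/
lemma exists_cells {X : Type} [MetricSpace X] [MeasurableSpace X] [BorelSpace X] {S : Set X}
    (hS : IsCompact S) (B : Set X) (hB : MeasurableSet B) {σ : ℝ} (hσ : 0 < σ) :
    ∃ (ι : Type) (_ : Fintype ι) (c : X → ι), (∀ i, MeasurableSet (c ⁻¹' {i})) ∧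
      (∀ x ∈ S, ∀ x', c x = c x' → dist x x' < σ) ∧ (∀ x x', c x = c x' → (x ∈ B ↔ x' ∈ B)) := by
  obtain ⟨t, -, htf, hcov⟩ := hS.finite_cover_balls (half_pos hσ)
  have : Finite t := htf
  let c : X → (t → Prop) × Prop := fun x => (fun i => x ∈ Metric.ball (i : X) (σ / 2), x ∈ B)
  have hc : Measurable c := by
    refine Measurable.prodMk ?_ ?_
    · refine measurable_pi_iff.2 fun i => ?_
      exact measurableSet_setOfPred.1 Metric.isOpen_ball.measurableSet
    · exact measurableSet_setOfPred.1 hB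
  refine ⟨_, Fintype.ofFinite _, c, fun i => hc (measurableSet_singleton i), ?_, ?_⟩
  · intro x hx x' h
    obtain ⟨i, hi, hxi⟩ := Set.mem_iUnion₂.1 (hcov hx)
    have h1 : (x ∈ Metric.ball i (σ / 2)) = (x' ∈ Metric.ball i (σ / 2)) :=
      congrFun (congrArg Prod.fst h) ⟨i, hi⟩
    have h2 : x' ∈ Metric.ball i (σ / 2) := h1 ▸ hxi
    rw [Metric.mem_ball] at hxi h2
    linarith [dist_triangle_right x x' i]
  · intro x x' h
    have h1 : (x ∈ B) = (x' ∈ B) := congrArg Prod.snd h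
    rw [h1]

lemma measureReal_cells {X ι : Type} [MeasurableSpace X] [Fintype ι] (μ : Measure X)
    [IsFiniteMeasure μ] (c : X → ι) (hc : ∀ i, MeasurableSet (c ⁻¹' {i})) (s : Finset ι) :
    μ.real (c ⁻¹' s) = ∑ i ∈ s, μ.real (c ⁻¹' {i}) := by
  have : c ⁻¹' (s : Set ι) = ⋃ i ∈ s, c ⁻¹' {i} := by ext x; simp
  rw [this, measureReal_biUnion_finset]
  · intro i _ j _ hij
    exact Disjoint.preimage _ (by simpa using hij)
  · exact fun i _ => hc i

lemma real_le_of_le {a b : ENNReal} {η : ℝ} (hη : 0 ≤ η) (hb : b ≠ ⊤)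
    (h : a ≤ b + ENNReal.ofReal η) : a.toReal ≤ b.toReal + η := by
  have := ENNReal.toReal_mono (ENNReal.add_ne_top.2 ⟨hb, ENNReal.ofReal_ne_top⟩) h
  rwa [ENNReal.toReal_add hb ENNReal.ofReal_ne_top, ENNReal.toReal_ofReal hη] at this

lemma le_of_real_le {a b : ENNReal} {η : ℝ} (hη : 0 ≤ η) (ha : a ≠ ⊤) (hb : b ≠ ⊤)
    (h : a.toReal ≤ b.toReal + η) : a ≤ b + ENNReal.ofReal η := by
  rw [← ENNReal.toReal_le_toReal ha (ENNReal.add_ne_top.2 ⟨hb, ENNReal.ofReal_ne_top⟩),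
    ENNReal.toReal_add hb ENNReal.ofReal_ne_top, ENNReal.toReal_ofReal hη]
  exact h

open Classical in
/-- One half of the Hall condition for the cell masses. -/
lemma hall_cond {X Y Z I J : Type} [MeasurableSpace X] [MeasurableSpace Y] [MetricSpace Z]
    [Fintype I] [Fintype J]
    (μ : Measure X) (ν : Measure Y) [IsFiniteMeasure μ] [IsFiniteMeasure ν]
    (S : Set X) (T : Set Y) (hS : μ Sᶜ = 0) (hT : ν Tᶜ = 0) (F : X → Z) (G : Y → Z)
    (c : X → I) (c' : Y → J) (hc : ∀ i, MeasurableSet (c ⁻¹' {i}))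
    (hc' : ∀ i, MeasurableSet (c' ⁻¹' {i})) (η σ : ℝ) (hη : 0 < η) (hσ : 0 < σ)
    (h : ∀ A, IsClosed A → μ (F ⁻¹' A) ≤ ν (G ⁻¹' Metric.cthickening η A) + ENNReal.ofReal η)
    (s : Finset I) :
    ∑ i ∈ s, μ.real (c ⁻¹' {i}) ≤
      ∑ j ∈ Finset.univ.filter (fun j => ∃ i ∈ s, ∃ x ∈ S, ∃ y ∈ T, c x = i ∧ c' y = j ∧
        dist (F x) (G y) ≤ η + σ), ν.real (c' ⁻¹' {j}) + η := by
  rw [← measureReal_cells μ c hc, ← measureReal_cells ν c' hc']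
  refine real_le_of_le hη.le (measure_ne_top _ _) ?_
  calc μ (c ⁻¹' s) ≤ μ (F ⁻¹' closure (F '' (c ⁻¹' s ∩ S))) :=
        measure_le_of_inter hS fun x hx => subset_closure (Set.mem_image_of_mem _ hx)
    _ ≤ _ := h _ isClosed_closure
    _ ≤ _ := by
      refine add_le_add ?_ le_rfl
      refine measure_le_of_inter hT ?_
      rintro y ⟨hy, hyT⟩
      rw [Set.mem_preimage, Metric.cthickening_closure] at hy
      have := Metric.cthickening_subset_thickening' (by linarith : 0 < η + σ)
        (by linarith : η < η + σ) _ hy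
      obtain ⟨_, ⟨x, ⟨hxs, hxS⟩, rfl⟩, hd⟩ := Metric.mem_thickening_iff.1 this
      simp only [Set.mem_preimage, Finset.coe_filter, Finset.mem_univ, true_and, Set.mem_ofPred_eq]
      refine ⟨c x, hxs, x, hxS, y, hyT, rfl, rfl, ?_⟩
      rw [dist_comm]
      exact hd.le

open Classical in
/-- Combinatorial heart of the transfer. `b i` says that the cell `i` lies in the kept part. -/
lemma transfer_sum1 {I J : Type} [Fintype I] [Fintype J] (m : I → ℝ) (n : J → ℝ) (p : I → J → ℝ)
    (b : I → Prop) (η : ℝ) (h0 : ∀ i j, 0 ≤ p i j) (hr : ∀ i, ∑ j, p i j ≤ m i)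
    (hc : ∀ j, ∑ i, p i j ≤ n j) (ht : ∑ i, m i - η ≤ ∑ i, ∑ j, p i j)
    (s : Finset I) (hs : ∀ i ∈ s, b i) (t : Finset J) (hst : ∀ i ∈ s, ∀ j, p i j ≠ 0 → j ∈ t) :
    ∑ i ∈ s, m i ≤ ∑ j ∈ t, (n j - ∑ i ∈ Finset.univ.filter (fun i => ¬ b i), p i j) + η := by
  have h1 : ∑ i ∈ s, (m i - ∑ j, p i j) ≤ ∑ i, (m i - ∑ j, p i j) :=
    Finset.sum_le_sum_of_subset_of_nonneg (Finset.subset_univ _)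
      fun i _ _ => sub_nonneg.2 (hr i)
  rw [Finset.sum_sub_distrib, Finset.sum_sub_distrib] at h1
  have h2 : ∑ i ∈ s, ∑ j, p i j = ∑ j ∈ t, ∑ i ∈ s, p i j := by
    rw [Finset.sum_comm (s := t)]
    refine Finset.sum_congr rfl fun i hi => ?_
    symm
    refine Finset.sum_subset (Finset.subset_univ _) fun j _ hj => ?_
    by_contra hne
    exact hj (hst i hi j hne)
  have h3 : ∑ j ∈ t, ∑ i ∈ s, p i j ≤
      ∑ j ∈ t, (n j - ∑ i ∈ Finset.univ.filter (fun i => ¬ b i), p i j) := by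
    refine Finset.sum_le_sum fun j _ => ?_
    have h4 : ∑ i ∈ s, p i j ≤ ∑ i ∈ Finset.univ.filter b, p i j :=
      Finset.sum_le_sum_of_subset_of_nonneg (fun i hi => by simpa using hs i hi)
        fun i _ _ => h0 i j
    have h5 := Finset.sum_filter_add_sum_filter_not Finset.univ b (fun i => p i j)
    linarith [hc j]
  linarith

open Classical in
lemma transfer_sum2 {I J : Type} [Fintype I] [Fintype J] (m : I → ℝ) (n : J → ℝ) (p : I → J → ℝ)
    (b : I → Prop) (η : ℝ) (h0 : ∀ i j, 0 ≤ p i j) (hr : ∀ i, ∑ j, p i j ≤ m i)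
    (hc : ∀ j, ∑ i, p i j ≤ n j) (ht : ∑ j, n j - η ≤ ∑ j, ∑ i, p i j)
    (s : Finset I) (t : Finset J) (hst : ∀ j ∈ t, ∀ i, b i → p i j ≠ 0 → i ∈ s) :
    ∑ j ∈ t, (n j - ∑ i ∈ Finset.univ.filter (fun i => ¬ b i), p i j) ≤ ∑ i ∈ s, m i + η := by
  have h1 : ∑ j ∈ t, (n j - ∑ i, p i j) ≤ ∑ j, (n j - ∑ i, p i j) :=
    Finset.sum_le_sum_of_subset_of_nonneg (Finset.subset_univ _)
      fun j _ _ => sub_nonneg.2 (hc j)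
  have h1' : ∑ j, (n j - ∑ i, p i j) ≤ η := by
    rw [Finset.sum_sub_distrib]; linarith
  have h2 : ∀ j ∈ t, (n j - ∑ i ∈ Finset.univ.filter (fun i => ¬ b i), p i j) ≤
      (n j - ∑ i, p i j) + ∑ i ∈ s, p i j := by
    intro j hj
    have h5 := Finset.sum_filter_add_sum_filter_not Finset.univ b (fun i => p i j)
    have h6 : ∑ i ∈ Finset.univ.filter b, p i j ≤ ∑ i ∈ s, p i j := by
      rw [Finset.sum_filter]
      calc _ ≤ ∑ i, if i ∈ s then p i j else 0 := by
            refine Finset.sum_le_sum fun i _ => ?_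
            by_cases hi : p i j = 0
            · simp [hi]
            · by_cases hb : b i
              · simp [hb, hst j hj i hb hi]
              · rw [if_neg hb]; split_ifs
                exacts [h0 i j, le_rfl]
        _ = _ := by simp
    linarith
  have h3 := Finset.sum_le_sum h2
  rw [Finset.sum_add_distrib, Finset.sum_comm] at h3
  have h4 : ∑ i ∈ s, ∑ j ∈ t, p i j ≤ ∑ i ∈ s, m i := by
    refine Finset.sum_le_sum fun i _ => le_trans ?_ (hr i)
    exact Finset.sum_le_sum_of_subset_of_nonneg (Finset.subset_univ _) fun j _ _ => h0 i j
  linarith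

lemma sum_cells {X ι : Type} [MeasurableSpace X] [Fintype ι] (μ : Measure X)
    (c : X → ι) (hc : ∀ i, MeasurableSet (c ⁻¹' {i})) (A : Set X) (hA : MeasurableSet A) :
    ∑ i, μ (A ∩ c ⁻¹' {i}) = μ A := by
  rw [← measure_biUnion_finset]
  · congr 1
    ext x; simp
  · intro i _ j _ hij
    refine Disjoint.mono Set.inter_subset_right Set.inter_subset_right ?_
    exact Disjoint.preimage _ (by simpa using hij)
  · exact fun i _ => hA.inter (hc i)

/-- Measure with constant densities on cells. -/
def cellMeas {X ι : Type} [MeasurableSpace X] [Fintype ι] (μ : Measure X)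
    (c : X → ι) (T : Set X) (k : ι → ℝ) : Measure X :=
  ∑ j, ENNReal.ofReal (k j) • μ.restrict (c ⁻¹' {j} ∩ T)

lemma cellMeas_apply {X ι : Type} [MeasurableSpace X] [Fintype ι] (μ : Measure X)
    (c : X → ι) (T : Set X) (k : ι → ℝ) (A : Set X) (hA : MeasurableSet A) :
    cellMeas μ c T k A = ∑ j, ENNReal.ofReal (k j) * μ (A ∩ (c ⁻¹' {j} ∩ T)) := by
  simp [cellMeas, Measure.finsetSum_apply, Measure.restrict_apply hA]

lemma cellMeas_real {X ι : Type} [MeasurableSpace X] [Fintype ι] (μ : Measure X)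
    [IsFiniteMeasure μ] (c : X → ι) (T : Set X) (k : ι → ℝ) (hk : ∀ j, 0 ≤ k j) (A : Set X)
    (hA : MeasurableSet A) :
    (cellMeas μ c T k A).toReal = ∑ j, k j * μ.real (A ∩ (c ⁻¹' {j} ∩ T)) := by
  rw [cellMeas_apply _ _ _ _ _ hA, ENNReal.toReal_sum]
  · refine Finset.sum_congr rfl fun j _ => ?_
    rw [ENNReal.toReal_mul, ENNReal.toReal_ofReal (hk j)]
    rfl
  · exact fun j _ => ENNReal.mul_ne_top ENNReal.ofReal_ne_top (measure_ne_top _ _)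

lemma cellMeas_le {X ι : Type} [MeasurableSpace X] [Fintype ι] (μ : Measure X)
    (c : X → ι) (hc : ∀ i, MeasurableSet (c ⁻¹' {i})) (T : Set X) (k : ι → ℝ)
    (hk : ∀ j, k j ≤ 1) : cellMeas μ c T k ≤ μ := by
  refine Measure.le_iff.2 fun A hA => ?_
  rw [cellMeas_apply _ _ _ _ _ hA, ← sum_cells μ c hc A hA]
  refine Finset.sum_le_sum fun j _ => ?_
  calc _ ≤ 1 * μ (A ∩ c ⁻¹' {j}) := by
        refine mul_le_mul' ?_ (measure_mono ?_)
        · rw [← ENNReal.ofReal_one]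
          exact ENNReal.ofReal_le_ofReal (hk j)
        · exact Set.inter_subset_inter_right _ Set.inter_subset_left
    _ = _ := one_mul _

open Classical in
lemma transfer {𝒳 𝒴 : PMM} {Z : Type} [MetricSpace Z] {F : 𝒳.carrier → Z} {G : 𝒴.carrier → Z}
    (hF : Isometry F) (hG : Isometry G) {η η' : ℝ} (hηη : η < η') {S : SubPMM 𝒳} {T : SubPMM 𝒴}
    (hS : S.IsCompactSub) (hT : T.IsCompactSub) (h : CloseIn F G η S T)
    (S' : SubPMM 𝒳) (hS'c : IsCompact S'.set) (hsub : S'.set ⊆ S.set)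
    (hS'm : S'.meas = S.meas.restrict S'.set) (C : Set 𝒴.carrier) (hCT : C ⊆ T.set)
    (hCm : MeasurableSet C)
    (hC : ∀ y ∈ C, ∀ x ∈ S.set, dist (F x) (G y) ≤ η' → x ∈ S'.set) :
    ∃ T' : SubPMM 𝒴, T'.IsCompactSub ∧ C ⊆ T'.set ∧ T.meas.restrict C ≤ T'.meas ∧
      CloseIn F G η' S' T' := by
  obtain ⟨h0, ho, hst, hts, hm⟩ := h
  have : IsFiniteMeasure S.meas := ⟨lt_top_iff_ne_top.2 hS.2⟩
  have : IsFiniteMeasure T.meas := ⟨lt_top_iff_ne_top.2 hT.2⟩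
  obtain ⟨σ, hσ, hσ'⟩ : ∃ σ : ℝ, 0 < σ ∧ η + 3 * σ = η' := ⟨(η' - η) / 3, by linarith, by ring⟩
  obtain ⟨I, _, c, hc, hcd, hcB⟩ := exists_cells hS.1 S'.set hS'c.measurableSet hσ
  obtain ⟨J, _, c', hc', hcd', -⟩ := exists_cells hT.1 ∅ MeasurableSet.empty hσ
  let R : I → J → Prop := fun i j => ∃ x ∈ S.set, ∃ y ∈ T.set, c x = i ∧ c' y = j ∧
        dist (F x) (G y) ≤ η + σ
  -- any two points of related cells are close
  have hRd : ∀ i j, R i j → ∀ x ∈ S.set, ∀ y ∈ T.set, c x = i → c' y = j →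
      dist (F x) (G y) ≤ η' := by
    rintro i j ⟨x0, hx0, y0, hy0, e1, e2, hd⟩ x hx y hy e3 e4
    have d1 := hcd x hx x0 (e3.trans e1.symm)
    have d2 := hcd' y0 hy0 y (e2.trans e4.symm)
    rw [← hF.dist_eq] at d1
    rw [← hG.dist_eq] at d2
    linarith [dist_triangle4 (F x) (F x0) (G y0) (G y)]
  let b : I → Prop := fun i => ∃ x ∈ S'.set, c x = i
  obtain ⟨p, hp0, hpR, hpr, hpc, hpt, hpt'⟩ := hall_deficit (fun i => S.meas.real (c ⁻¹' {i}))
    (fun j => T.meas.real (c' ⁻¹' {j})) R η h0.le (fun _ => measureReal_nonneg)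
    (fun _ => measureReal_nonneg)
    (fun s => hall_cond S.meas T.meas S.set T.set S.supported T.supported F G c c' hc hc' η σ h0 hσ
      (fun A hA => (hm A hA).1) s)
    (fun s => by
      have := hall_cond T.meas S.meas T.set S.set T.supported S.supported G F c' c hc' hc η σ h0 hσ
        (fun A hA => (hm A hA).2) s
      convert this using 5 with i
      funext j
      refine propext (and_congr_right fun _ => ?_)
      constructor
      · rintro ⟨x, hx, y, hy, e1, e2, hd⟩
        exact ⟨y, hy, x, hx, e2, e1, by rwa [dist_comm]⟩
      · rintro ⟨y, hy, x, hx, e2, e1, hd⟩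
        exact ⟨x, hx, y, hy, e1, e2, by rwa [dist_comm]⟩)
  set m : I → ℝ := fun i => S.meas.real (c ⁻¹' {i}) with hmdef
  set n : J → ℝ := fun j => T.meas.real (c' ⁻¹' {j}) with hndef
  let q : J → ℝ := fun j => ∑ i ∈ Finset.univ.filter (fun i => ¬ b i), p i j
  have hq0 : ∀ j, 0 ≤ q j := fun j => Finset.sum_nonneg fun i _ => hp0 i j
  have hqn : ∀ j, q j ≤ n j := fun j => le_trans
    (Finset.sum_le_sum_of_subset_of_nonneg (Finset.subset_univ _) fun i _ _ => hp0 i j) (hpc j)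
  let k : J → ℝ := fun j => 1 - q j / n j
  have hn0 : ∀ j, 0 ≤ n j := fun j => measureReal_nonneg
  have hk1 : ∀ j, k j ≤ 1 := fun j => sub_le_self _ (div_nonneg (hq0 j) (hn0 j))
  have hk0 : ∀ j, 0 ≤ k j := fun j => sub_nonneg.2 (div_le_one_of_le₀ (hqn j) (hn0 j))
  have hkn : ∀ j, k j * n j = n j - q j := by
    intro j
    rcases (hn0 j).eq_or_lt with hz | hpos
    · have : q j = 0 := le_antisymm (by rw [hz]; exact hqn j) (hq0 j)
      rw [← hz, this]; ring
    · simp only [k]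
      field_simp
  let T1 : Set 𝒴.carrier := T.set ∩ G ⁻¹' Metric.cthickening η' (F '' S'.set)
  have hT1c : IsCompact T1 :=
    hT.1.inter_right (Metric.isClosed_cthickening.preimage hG.continuous)
  have hT1m := hT1c.measurableSet
  have hη'0 : 0 < η' := h0.trans hηη
  have hT1 : ∀ y ∈ T.set, ∀ x ∈ S'.set, dist (F x) (G y) ≤ η' → y ∈ T1 := by
    intro y hy x hx hd
    exact ⟨hy, Metric.mem_cthickening_of_dist_le _ (F x) _ _ ⟨x, hx, rfl⟩ (by rwa [dist_comm])⟩
  have hle : cellMeas T.meas c' T1 k ≤ T.meas := cellMeas_le _ _ hc' _ _ hk1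
  have hCT1 : C ⊆ T1 := by
    intro y hy
    obtain ⟨x, hx, hd⟩ := hts y (hCT hy)
    exact hT1 y (hCT hy) x (hC y hy x hx (hd.trans hηη.le)) (hd.trans hηη.le)
  let T' : SubPMM 𝒴 :=
    { set := T1
      root_mem := hT1 _ T.root_mem _ S'.root_mem (ho.trans hηη.le)
      meas := cellMeas T.meas c' T1 k
      meas_le := hle.trans T.meas_le
      supported := by
        rw [cellMeas_apply _ _ _ _ _ hT1m.compl]
        refine Finset.sum_eq_zero fun j _ => ?_
        have : T1ᶜ ∩ (c' ⁻¹' {j} ∩ T1) = ∅ := by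
          ext y; simp only [Set.mem_inter_iff, Set.mem_compl_iff, Set.mem_empty_iff_false]; tauto
        rw [this]; simp }
  have hTfin : ∀ A, T'.meas A ≠ ⊤ := fun A =>
    ne_top_of_le_ne_top (measure_ne_top T.meas A) (hle A)
  have hSfin : ∀ A, S'.meas A ≠ ⊤ := fun A => by
    rw [hS'm]; exact measure_ne_top _ _
  refine ⟨T', ⟨hT1c, hTfin _⟩, hCT1, ?_, hη'0, ho.trans hηη.le, ?_, ?_, ?_⟩
  · refine Measure.le_iff.2 fun A hA => ?_
    change _ ≤ cellMeas T.meas c' T1 k A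
    rw [Measure.restrict_apply hA, cellMeas_apply _ _ _ _ _ hA,
      ← sum_cells T.meas c' hc' _ (hA.inter hCm)]
    refine Finset.sum_le_sum fun j _ => ?_
    by_cases hj : (A ∩ C ∩ c' ⁻¹' {j}).Nonempty
    · obtain ⟨y, ⟨-, hyC⟩, hyj⟩ := hj
      have hq : q j = 0 := by
        refine Finset.sum_eq_zero fun i hi => ?_
        by_contra hne
        have hR := hpR i j hne
        obtain ⟨x, hx, -, -, hxi, -, -⟩ := hR
        have hd := hRd i j (hpR i j hne) x hx y (hCT hyC) hxi hyj
        exact (Finset.mem_filter.1 hi).2 ⟨x, hC y hyC x hx hd, hxi⟩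
      have hk : k j = 1 := by simp only [k, hq]; simp
      rw [hk, ENNReal.ofReal_one, one_mul]
      refine measure_mono ?_
      rintro z ⟨⟨h1, h2⟩, h3⟩
      exact ⟨h1, h3, hCT1 h2⟩
    · rw [Set.not_nonempty_iff_eq_empty.1 hj]; simp
  · intro x hx
    obtain ⟨y, hy, hd⟩ := hst x (hsub hx)
    exact ⟨y, hT1 y hy x hx (hd.trans hηη.le), hd.trans hηη.le⟩
  · rintro y ⟨hy, hyc⟩
    rw [Set.mem_preimage,
      (hS'c.image hF.continuous).cthickening_eq_biUnion_closedBall hη'0.le] at hyc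
    obtain ⟨_, ⟨x, hx, rfl⟩, hd⟩ := Set.mem_iUnion₂.1 hyc
    exact ⟨x, hx, by rw [dist_comm]; exact hd⟩
  · intro A hA
    have hFA : MeasurableSet (F ⁻¹' A) := (hA.preimage hF.continuous).measurableSet
    have hGA : MeasurableSet (G ⁻¹' A) := (hA.preimage hG.continuous).measurableSet
    have hAc : IsClosed (Metric.cthickening η' A) := Metric.isClosed_cthickening
    have hFA' : MeasurableSet (F ⁻¹' Metric.cthickening η' A) :=
      (hAc.preimage hF.continuous).measurableSet
    have hGA' : MeasurableSet (G ⁻¹' Metric.cthickening η' A) :=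
      (hAc.preimage hG.continuous).measurableSet
    constructor
    · refine le_of_real_le hη'0.le (hSfin _) (hTfin _) ?_
      change _ ≤ (cellMeas T.meas c' T1 k _).toReal + _
      rw [cellMeas_real _ _ _ _ hk0 _ hGA', hS'm, Measure.restrict_apply hFA]
      let s : Finset I := Finset.univ.filter (fun i => ∃ x ∈ S'.set, F x ∈ A ∧ c x = i)
      let t : Finset J := Finset.univ.filter (fun j => ∃ i ∈ s, p i j ≠ 0)
      have h1 : S.meas.real (F ⁻¹' A ∩ S'.set) ≤ ∑ i ∈ s, m i := by
        rw [hmdef, ← measureReal_cells S.meas c hc s]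
        refine measureReal_mono ?_
        rintro x ⟨hxA, hxB⟩
        simp only [s, Set.mem_preimage, Finset.coe_filter, Finset.mem_univ, true_and,
          Set.mem_ofPred_eq]
        exact ⟨x, hxB, hxA, rfl⟩
      have h2 := transfer_sum1 m n p b η hp0 hpr hpc hpt s (by
        intro i hi
        obtain ⟨x, hx, -, hxi⟩ := (Finset.mem_filter.1 hi).2
        exact ⟨x, hx, hxi⟩) t (fun i hi j hij => by simp only [t, Finset.mem_filter]; exact ⟨Finset.mem_univ _, i, hi, hij⟩)
      have h3 : ∑ j ∈ t, (n j - q j) ≤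
          ∑ j, k j * T.meas.real (G ⁻¹' Metric.cthickening η' A ∩ (c' ⁻¹' {j} ∩ T1)) := by
        refine le_trans (Finset.sum_le_sum fun j hj => ?_)
          (Finset.sum_le_sum_of_subset_of_nonneg (Finset.subset_univ t)
            fun j _ _ => mul_nonneg (hk0 j) measureReal_nonneg)
        rw [← hkn j]
        refine mul_le_mul_of_nonneg_left ?_ (hk0 j)
        obtain ⟨i, hi, hij⟩ := (Finset.mem_filter.1 hj).2
        obtain ⟨x, hx, hxA, hxi⟩ := (Finset.mem_filter.1 hi).2
        refine ENNReal.toReal_mono (measure_ne_top _ _) ?_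
        refine measure_le_of_inter T.supported ?_
        rintro y ⟨hyj, hyT⟩
        have hd := hRd i j (hpR i j hij) x (hsub hx) y hyT hxi hyj
        exact ⟨Metric.mem_cthickening_of_dist_le _ (F x) _ _ hxA (by rwa [dist_comm]), hyj,
          hT1 y hyT x hx hd⟩
      change S.meas.real (F ⁻¹' A ∩ S'.set) ≤ _
      linarith
    · refine le_of_real_le hη'0.le (hTfin _) (hSfin _) ?_
      change (cellMeas T.meas c' T1 k _).toReal ≤ _
      rw [cellMeas_real _ _ _ _ hk0 _ hGA, hS'm, Measure.restrict_apply hFA']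
      let t : Finset J := Finset.univ.filter (fun j => ∃ y ∈ T.set, G y ∈ A ∧ c' y = j)
      let s : Finset I := Finset.univ.filter (fun i => b i ∧ ∃ j ∈ t, p i j ≠ 0)
      have h1 : ∑ i ∈ s, m i ≤ S.meas.real (F ⁻¹' Metric.cthickening η' A ∩ S'.set) := by
        rw [hmdef, ← measureReal_cells S.meas c hc s]
        refine ENNReal.toReal_mono (measure_ne_top _ _) ?_
        refine measure_le_of_inter S.supported ?_
        rintro x ⟨hxs, hxS⟩
        obtain ⟨⟨x', hx', hxx'⟩, j, hj, hij⟩ := (Finset.mem_filter.1 (Finset.mem_coe.1 hxs)).2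
        obtain ⟨y, hy, hyA, hyj⟩ := (Finset.mem_filter.1 hj).2
        have hd := hRd _ j (hpR _ j hij) x hxS y hy rfl hyj
        exact ⟨Metric.mem_cthickening_of_dist_le _ (G y) _ _ hyA hd, (hcB _ _ hxx').1 hx'⟩
      have h2 := transfer_sum2 m n p b η hp0 hpr hpc hpt' s t (by
        intro j hj i hb hij
        exact Finset.mem_filter.2 ⟨Finset.mem_univ _, hb, j, hj, hij⟩)
      have h3 : ∑ j, k j * T.meas.real (G ⁻¹' A ∩ (c' ⁻¹' {j} ∩ T1)) ≤ ∑ j ∈ t, (n j - q j) := by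
        rw [← Finset.sum_subset (Finset.subset_univ t)]
        · refine Finset.sum_le_sum fun j hj => ?_
          rw [← hkn j]
          refine mul_le_mul_of_nonneg_left ?_ (hk0 j)
          exact measureReal_mono fun y hy => hy.2.1
        · intro j _ hj
          have : G ⁻¹' A ∩ (c' ⁻¹' {j} ∩ T1) = ∅ := by
            ext y
            simp only [Set.mem_empty_iff_false, iff_false]
            rintro ⟨hyA, hyj, hyT⟩
            exact hj (Finset.mem_filter.2 ⟨Finset.mem_univ _, y, hyT.1, hyA, hyj⟩)
          rw [this]; simp
      change _ ≤ S.meas.real (F ⁻¹' Metric.cthickening η' A ∩ S'.set) + _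
      linarith

lemma ballSub_set {𝒳 : PMM} {r : ℝ} (hr : 0 ≤ r) :
    (𝒳.ballSub r).set = Metric.closedBall 𝒳.basepoint r :=
  Set.insert_eq_of_mem (Metric.mem_closedBall_self hr)

lemma ballSub_meas {𝒳 : PMM} {r : ℝ} (hr : 0 ≤ r) :
    (𝒳.ballSub r).meas = 𝒳.meas.restrict (Metric.closedBall 𝒳.basepoint r) :=
  congrArg (fun s => 𝒳.meas.restrict s) (ballSub_set (𝒳 := 𝒳) hr)

lemma ballSub_compact {𝒳 : PMM} (h : 𝒳.BoundedlyCompact) {r : ℝ} (hr : 0 ≤ r) :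
    (𝒳.ballSub r).IsCompactSub := by
  refine ⟨?_, ?_⟩
  · rw [ballSub_set hr]; exact h.1 _ _
  · rw [ballSub_meas hr, Measure.restrict_apply_univ]; exact h.2 _ _

lemma cGHP_nonneg (𝒳 𝒴 : PMM) : 0 ≤ cGHP 𝒳 𝒴 := by
  refine Real.sInf_nonneg ?_
  rintro x ⟨e, -, rfl⟩
  exact le_max_of_le_left dist_nonneg

lemma exists_close_of_aFun_lt {𝒳 𝒴 : PMM} (h𝒳 : 𝒳.BoundedlyCompact) (h𝒴 : 𝒴.BoundedlyCompact)
    {ε r c : ℝ} (hr : 0 ≤ r) (hrε : 0 ≤ r - ε) (h : aFun ε r 𝒳 𝒴 < c) :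
    ∃ T : SubPMM 𝒴, T.IsCompactSub ∧ 𝒴.ballSub (r - ε) ≤ T ∧
      ∃ η < c, Close η (𝒳.ballSub r) T := by
  obtain ⟨_, ⟨T, hT, hle, rfl⟩, hlt⟩ := exists_lt_of_csInf_lt (by
    exact ⟨_, 𝒴.ballSub (r - ε), ballSub_compact h𝒴 hrε, ⟨le_rfl, le_rfl⟩, rfl⟩) h
  exact ⟨T, hT, hle, close_of_cGHP_lt (ballSub_compact h𝒳 hr) hT hlt⟩

lemma aFun_le_of_close {𝒳 𝒴 : PMM} (h𝒳 : 𝒳.BoundedlyCompact)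
    {ε r η : ℝ} (hr : 0 ≤ r) (T : SubPMM 𝒴) (hT : T.IsCompactSub)
    (hle : 𝒴.ballSub (r - ε) ≤ T) (h : Close η (𝒳.ballSub r) T) : aFun ε r 𝒳 𝒴 ≤ η := by
  have hb : BddBelow {x : ℝ | ∃ Y' : SubPMM 𝒴, Y'.IsCompactSub ∧ 𝒴.ballSub (r - ε) ≤ Y' ∧
      x = cGHP ((𝒳.ballSub r).toPMM) Y'.toPMM} := by
    refine ⟨0, ?_⟩
    rintro x ⟨T, -, -, rfl⟩
    exact cGHP_nonneg _ _
  exact (csInf_le hb ⟨T, hT, hle, rfl⟩).trans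
    (cGHP_le_of_close (ballSub_compact h𝒳 hr).1.measurableSet hT.1.measurableSet h)

lemma radius_nonneg {ε : ℝ} (h0 : 0 < ε) (h1 : ε ≤ 1) : 0 ≤ 1 / ε - ε := by
  have : 1 ≤ 1 / ε := by rw [le_div_iff₀ h0]; linarith
  linarith

lemma aEps_mono {𝒳 𝒴 : PMM} (h𝒳 : 𝒳.BoundedlyCompact) (h𝒴 : 𝒴.BoundedlyCompact) {ε γ : ℝ}
    (h0 : 0 < ε) (hεγ : ε < γ) (h1 : γ ≤ 1) (h : aEps ε 𝒳 𝒴 < ε / 2) : aEps γ 𝒳 𝒴 < γ / 2 := by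
  have hγ0 : 0 < γ := h0.trans hεγ
  have rε := radius_nonneg h0 (hεγ.le.trans h1)
  have rγ := radius_nonneg hγ0 h1
  have rε' : 0 ≤ 1 / ε := by positivity
  have rγ' : 0 ≤ 1 / γ := by positivity
  have hinv : 1 / γ ≤ 1 / ε := one_div_le_one_div_of_le h0 hεγ.le
  obtain ⟨T, hT, hle, η, hη, Z, mZ, F, G, hF, hG, hcl⟩ :=
    exists_close_of_aFun_lt h𝒳 h𝒴 rε' rε h
  have hcT : Metric.closedBall 𝒴.basepoint (1 / γ - γ) ⊆
      Metric.closedBall 𝒴.basepoint (1 / ε - ε) := Metric.closedBall_subset_closedBall (by linarith)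
  have hle1 := hle.1
  have hle2 := hle.2
  rw [ballSub_set rε] at hle1
  rw [ballSub_meas rε] at hle2
  obtain ⟨T', hT', hC1, hC2, hcl'⟩ := transfer hF hG hη (ballSub_compact h𝒳 rε') hT hcl
    (𝒳.ballSub (1 / γ)) (ballSub_compact h𝒳 rγ').1
    (by rw [ballSub_set rγ', ballSub_set rε']; exact Metric.closedBall_subset_closedBall hinv)
    (by
      rw [ballSub_meas rγ', ballSub_set rγ', ballSub_meas rε',
        Measure.restrict_restrict Metric.isClosed_closedBall.measurableSet,
        Set.inter_eq_left.2 (Metric.closedBall_subset_closedBall hinv)])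
    (Metric.closedBall 𝒴.basepoint (1 / γ - γ)) (hcT.trans hle1)
    Metric.isClosed_closedBall.measurableSet
    (by
      intro y hy x hx hd
      rw [ballSub_set rγ', Metric.mem_closedBall]
      rw [Metric.mem_closedBall] at hy
      have ho := hcl.2.1
      rw [← hF.dist_eq]
      rw [← hG.dist_eq] at hy
      have := dist_triangle4 (F x) (G y) (G 𝒴.basepoint) (F 𝒳.basepoint)
      rw [dist_comm (G 𝒴.basepoint)] at this
      linarith)
  have : aEps γ 𝒳 𝒴 ≤ ε / 2 := by
    refine aFun_le_of_close h𝒳 rγ' T' hT' ⟨?_, ?_⟩ ⟨Z, mZ, F, G, hF, hG, hcl'⟩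
    · rw [ballSub_set rγ]; exact hC1
    · rw [ballSub_meas rγ]
      refine le_trans ?_ hC2
      have := Measure.restrict_mono_measure hle2 (Metric.closedBall 𝒴.basepoint (1 / γ - γ))
      rwa [Measure.restrict_restrict Metric.isClosed_closedBall.measurableSet,
        Set.inter_eq_left.2 hcT] at this
  linarith

lemma annulus {𝒳 : PMM} (h : 𝒳.BoundedlyCompact) {r0 κ : ℝ} (hr0 : 0 ≤ r0) (hκ : 0 < κ) :
    ∀ᶠ r in 𝓝[>] r0,
      (∀ x ∈ Metric.closedBall 𝒳.basepoint r, ∃ x' ∈ Metric.closedBall 𝒳.basepoint r0,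
        dist x x' ≤ κ) ∧
      𝒳.meas (Metric.closedBall 𝒳.basepoint r \ Metric.closedBall 𝒳.basepoint r0) ≤
        ENNReal.ofReal κ := by
  set o := 𝒳.basepoint
  refine Eventually.and ?_ ?_
  · have hK : IsCompact (Metric.closedBall o (r0 + 1) \
        Metric.thickening κ (Metric.closedBall o r0)) :=
      (h.1 _ _).diff Metric.isOpen_thickening
    have hex : ∃ ρ > r0, ∀ x ∈ Metric.closedBall o (r0 + 1) \
        Metric.thickening κ (Metric.closedBall o r0), ρ ≤ dist x o := by
      rcases Set.eq_empty_or_nonempty (Metric.closedBall o (r0 + 1) \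
        Metric.thickening κ (Metric.closedBall o r0)) with he | hne
      · exact ⟨r0 + 1, by linarith, by rw [he]; simp⟩
      · obtain ⟨x0, hx0, hmin⟩ := hK.exists_isMinOn hne
          (continuous_id.dist continuous_const : Continuous fun x => dist x o).continuousOn
        refine ⟨dist x0 o, ?_, fun x hx => hmin hx⟩
        by_contra hc
        exact hx0.2 (Metric.self_subset_thickening hκ _ (Metric.mem_closedBall.2 (not_lt.1 hc)))
    obtain ⟨ρ, hρ, hρ'⟩ := hex
    have hmin : r0 < min ρ (r0 + 1) := lt_min hρ (by linarith)
    filter_upwards [Ioo_mem_nhdsGT hmin] with r hr x hx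
    rw [Metric.mem_closedBall] at hx
    obtain ⟨hr1, hr2⟩ := lt_min_iff.1 hr.2
    have : x ∈ Metric.thickening κ (Metric.closedBall o r0) := by
      by_contra hc
      have := hρ' x ⟨Metric.mem_closedBall.2 (by linarith), hc⟩
      linarith
    obtain ⟨x', hx', hd⟩ := Metric.mem_thickening_iff.1 this
    exact ⟨x', hx', hd.le⟩
  · have ht := tendsto_measure_biInter_gt (μ := 𝒳.meas)
      (s := fun r => Metric.closedBall o r \ Metric.closedBall o r0) (a := r0)
      (fun r _ => (Metric.isClosed_closedBall.measurableSet.diff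
        Metric.isClosed_closedBall.measurableSet).nullMeasurableSet)
      (fun i j _ hij => Set.diff_subset_diff_left (Metric.closedBall_subset_closedBall hij))
      ⟨r0 + 1, by simp, ne_top_of_le_ne_top (h.2 o (r0 + 1)) (measure_mono Set.diff_subset)⟩
    have he : (⋂ r > r0, Metric.closedBall o r \ Metric.closedBall o r0) = ∅ := by
      ext x
      simp only [Set.mem_iInter, Set.mem_empty_iff_false, iff_false, not_forall]
      by_cases hx : x ∈ Metric.closedBall o r0
      · exact ⟨r0 + 1, by simp, fun hh => hh.2 hx⟩
      · rw [Metric.mem_closedBall, not_le] at hx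
        obtain ⟨r, h1, h2⟩ := exists_between hx
        exact ⟨r, h1, fun hh => absurd (Metric.mem_closedBall.1 hh.1) (not_le.2 h2)⟩
    rw [he, measure_empty] at ht
    exact (ht.eventually (gt_mem_nhds (ENNReal.ofReal_pos.2 hκ))).mono fun r hr => le_of_lt hr

/-- Enlarge a pmm-subspace by a ball. -/
def enlarge {𝒴 : PMM} (T : SubPMM 𝒴) (b : Set 𝒴.carrier) (hb : MeasurableSet b) : SubPMM 𝒴 where
  set := T.set ∪ b
  root_mem := Or.inl T.root_mem
  meas := T.meas.restrict bᶜ + 𝒴.meas.restrict b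
  meas_le := by
    calc T.meas.restrict bᶜ + 𝒴.meas.restrict b
        ≤ 𝒴.meas.restrict bᶜ + 𝒴.meas.restrict b :=
          add_le_add (Measure.restrict_mono_measure T.meas_le _) le_rfl
      _ = 𝒴.meas := Measure.restrict_compl_add_restrict hb
  supported := by
    rw [Measure.add_apply, add_eq_zero]
    constructor
    · refine le_antisymm ((Measure.restrict_apply_le _ _).trans ?_) bot_le
      rw [← T.supported]
      exact measure_mono (Set.compl_subset_compl.2 Set.subset_union_left)
    · have h1 : 𝒴.meas.restrict b bᶜ = 0 := by
        rw [Measure.restrict_apply hb.compl]; simp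
      refine le_antisymm ?_ bot_le
      rw [← h1]
      exact measure_mono (Set.compl_subset_compl.2 Set.subset_union_right)

lemma aEps_left {𝒳 𝒴 : PMM} (h𝒳 : 𝒳.BoundedlyCompact) (h𝒴 : 𝒴.BoundedlyCompact) {δ : ℝ}
    (h0 : 0 < δ) (h1 : δ ≤ 1) (h : aEps δ 𝒳 𝒴 < δ / 2) :
    ∀ᶠ ε in 𝓝[<] δ, aEps ε 𝒳 𝒴 < ε / 2 := by
  have rδ := radius_nonneg h0 h1
  have rδ' : 0 ≤ 1 / δ := by positivity
  obtain ⟨T, hT, hle, η, hη, Z, mZ, F, G, hF, hG, hη0, ho, hst, hts, hm⟩ :=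
    exists_close_of_aFun_lt h𝒳 h𝒴 rδ' rδ h
  obtain ⟨η2, hη1, hη2⟩ := exists_between hη
  have hκ : 0 < η2 - η := by linarith
  have hpos : ∀ᶠ ε in 𝓝[<] δ, 0 < ε ∧ 2 * η2 < ε ∧ ε < δ := by
    filter_upwards [Ioo_mem_nhdsLT (max_lt h0 (by linarith : 2 * η2 < δ))] with ε hε
    obtain ⟨a, b⟩ := max_lt_iff.1 hε.1
    exact ⟨a, b, hε.2⟩
  have c1 : Tendsto (fun ε : ℝ => 1 / ε) (𝓝[<] δ) (𝓝 (1 / δ)) := by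
    have : ContinuousAt (fun ε : ℝ => 1 / ε) δ := by
      simpa using continuousAt_inv₀ h0.ne'
    exact this.tendsto.mono_left nhdsWithin_le_nhds
  have c2 : Tendsto (fun ε : ℝ => 1 / ε - ε) (𝓝[<] δ) (𝓝 (1 / δ - δ)) :=
    c1.sub (tendsto_id.mono_left nhdsWithin_le_nhds)
  have t1 : Tendsto (fun ε : ℝ => 1 / ε) (𝓝[<] δ) (𝓝[>] (1 / δ)) :=
    tendsto_nhdsWithin_iff.2 ⟨c1, hpos.mono fun ε hε => one_div_lt_one_div_of_lt hε.1 hε.2.2⟩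
  have t2 : Tendsto (fun ε : ℝ => 1 / ε - ε) (𝓝[<] δ) (𝓝[>] (1 / δ - δ)) :=
    tendsto_nhdsWithin_iff.2 ⟨c2, hpos.mono fun ε hε => by
      have := one_div_lt_one_div_of_lt hε.1 hε.2.2
      have := hε.2.2
      simp only [Set.mem_Ioi]
      linarith⟩
  filter_upwards [hpos, t1.eventually (annulus h𝒳 rδ' hκ), t2.eventually (annulus h𝒴 rδ hκ)]
    with ε hε hX hY
  obtain ⟨hε0, hεη, hεδ⟩ := hε
  obtain ⟨hX1, hX2⟩ := hX
  obtain ⟨hY1, hY2⟩ := hY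
  have rε := radius_nonneg hε0 (hεδ.le.trans h1)
  have rε' : 0 ≤ 1 / ε := by positivity
  have hinv : 1 / δ ≤ 1 / ε := one_div_le_one_div_of_le hε0 hεδ.le
  have hle1 := hle.1
  have hle2 := hle.2
  rw [ballSub_set rδ] at hle1
  rw [ballSub_meas rδ] at hle2
  rw [ballSub_set rδ'] at hst hts
  rw [ballSub_meas rδ'] at hm
  set bX0 := Metric.closedBall 𝒳.basepoint (1 / δ)
  set bX := Metric.closedBall 𝒳.basepoint (1 / ε) with hbX
  set b0 := Metric.closedBall 𝒴.basepoint (1 / δ - δ)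
  set b := Metric.closedBall 𝒴.basepoint (1 / ε - ε) with hb
  have hb0m : MeasurableSet b0 := Metric.isClosed_closedBall.measurableSet
  have hbm : MeasurableSet b := Metric.isClosed_closedBall.measurableSet
  have hXX : bX0 ⊆ bX := Metric.closedBall_subset_closedBall hinv
  have hbb : b0 ⊆ b := Metric.closedBall_subset_closedBall (by linarith)
  let T2 := enlarge T b hbm
  have hofr : ENNReal.ofReal η2 = ENNReal.ofReal η + ENNReal.ofReal (η2 - η) := by
    rw [← ENNReal.ofReal_add hη0.le hκ.le]; congr 1; ring
  -- mass comparisons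
  have mX1 : ∀ A, 𝒳.meas.restrict bX0 A ≤ 𝒳.meas.restrict bX A := fun A =>
    Measure.restrict_mono_set _ hXX A
  have mX2 : ∀ A, MeasurableSet A →
      𝒳.meas.restrict bX A ≤ 𝒳.meas.restrict bX0 A + ENNReal.ofReal (η2 - η) := by
    intro A hA
    rw [Measure.restrict_apply hA, Measure.restrict_apply hA]
    refine le_trans (measure_mono ?_) ((measure_union_le _ _).trans (add_le_add le_rfl hX2))
    rintro x ⟨hx, hxb⟩
    by_cases hx0 : x ∈ bX0
    exacts [Or.inl ⟨hx, hx0⟩, Or.inr ⟨hxb, hx0⟩]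
  have mY1 : ∀ A, T.meas A ≤ T2.meas A := by
    have : T.meas ≤ T2.meas := by
      calc T.meas = T.meas.restrict bᶜ + T.meas.restrict b :=
            (Measure.restrict_compl_add_restrict hbm).symm
        _ ≤ _ := add_le_add le_rfl (Measure.restrict_mono_measure T.meas_le _)
    exact this
  have mY2 : ∀ A, MeasurableSet A → T2.meas A ≤ T.meas A + ENNReal.ofReal (η2 - η) := by
    intro A hA
    change (T.meas.restrict bᶜ + 𝒴.meas.restrict b) A ≤ _
    rw [Measure.add_apply, Measure.restrict_apply hA, Measure.restrict_apply hA]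
    have g1 : 𝒴.meas (A ∩ b) ≤ 𝒴.meas (A ∩ b0) + ENNReal.ofReal (η2 - η) := by
      refine le_trans (measure_mono ?_) ((measure_union_le _ _).trans (add_le_add le_rfl hY2))
      rintro x ⟨hx, hxb⟩
      by_cases hx0 : x ∈ b0
      exacts [Or.inl ⟨hx, hx0⟩, Or.inr ⟨hxb, hx0⟩]
    have g2 : 𝒴.meas (A ∩ b0) ≤ T.meas (A ∩ b0) := by
      have := hle2 (A ∩ b0)
      rwa [Measure.restrict_apply (hA.inter hb0m), Set.inter_assoc, Set.inter_self] at this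
    have g3 : T.meas (A ∩ bᶜ) + T.meas (A ∩ b0) ≤ T.meas A := by
      rw [← measure_union _ (hA.inter hb0m)]
      · exact measure_mono (Set.union_subset Set.inter_subset_left Set.inter_subset_left)
      · refine Set.disjoint_left.2 ?_
        rintro x ⟨-, hx⟩ ⟨-, hx'⟩
        exact hx (hbb hx')
    calc T.meas (A ∩ bᶜ) + 𝒴.meas (A ∩ b)
        ≤ T.meas (A ∩ bᶜ) + (T.meas (A ∩ b0) + ENNReal.ofReal (η2 - η)) :=
          add_le_add le_rfl (g1.trans (add_le_add g2 le_rfl))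
      _ = (T.meas (A ∩ bᶜ) + T.meas (A ∩ b0)) + ENNReal.ofReal (η2 - η) := (add_assoc _ _ _).symm
      _ ≤ _ := add_le_add g3 le_rfl
  have hT2 : T2.IsCompactSub := by
    refine ⟨hT.1.union (h𝒴.1 _ _), ?_⟩
    exact ne_top_of_le_ne_top (ENNReal.add_ne_top.2 ⟨hT.2, ENNReal.ofReal_ne_top⟩)
      (mY2 _ MeasurableSet.univ)
  have hthick : ∀ A : Set Z, Metric.cthickening η A ⊆ Metric.cthickening η2 A := fun A =>
    Metric.cthickening_mono hη1.le A
  have key : aEps ε 𝒳 𝒴 ≤ η2 := by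
    refine aFun_le_of_close h𝒳 rε' T2 hT2 ⟨?_, ?_⟩
      ⟨Z, mZ, F, G, hF, hG, hη0.trans hη1, ho.trans hη1.le, ?_, ?_, ?_⟩
    · rw [ballSub_set rε]; exact Set.subset_union_right
    · rw [ballSub_meas rε]
      exact Measure.le_add_left le_rfl
    · rw [ballSub_set rε']
      intro x hx
      obtain ⟨x', hx', hd⟩ := hX1 x hx
      obtain ⟨y, hy, hd'⟩ := hst x' hx'
      rw [← hF.dist_eq] at hd
      exact ⟨y, Or.inl hy, by linarith [dist_triangle (F x) (F x') (G y)]⟩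
    · rw [ballSub_set rε']
      rintro y (hy | hy)
      · obtain ⟨x, hx, hd⟩ := hts y hy
        exact ⟨x, hXX hx, hd.trans hη1.le⟩
      · obtain ⟨y', hy', hd⟩ := hY1 y hy
        obtain ⟨x, hx, hd'⟩ := hts y' (hle1 hy')
        rw [← hG.dist_eq, dist_comm] at hd
        exact ⟨x, hXX hx, by linarith [dist_triangle (F x) (G y') (G y)]⟩
    · rw [ballSub_meas rε']
      intro A hA
      obtain ⟨q1, q2⟩ := hm A hA
      rw [hofr, ← add_assoc, ← add_assoc]
      constructor
      · refine (mX2 _ (hA.preimage hF.continuous).measurableSet).trans (add_le_add ?_ le_rfl)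
        refine q1.trans (add_le_add ?_ le_rfl)
        exact (mY1 _).trans (measure_mono (Set.preimage_mono (hthick A)))
      · refine (mY2 _ (hA.preimage hG.continuous).measurableSet).trans (add_le_add ?_ le_rfl)
        refine q2.trans (add_le_add ?_ le_rfl)
        exact (mX1 _).trans (measure_mono (Set.preimage_mono (hthick A)))
  linarith

/-- For boundedly compact pmm spaces `𝒳`, `𝒴`: if `δ := d(𝒳,𝒴) > 0` then
`a_δ(𝒳,𝒴) ∨ a_δ(𝒴,𝒳) ≥ δ/2`; and if `d(𝒳,𝒴) < γ ≤ 1` then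
`a_γ(𝒳,𝒴) ∨ a_γ(𝒴,𝒳) < γ/2`. -/
theorem GHP_ineqs (𝒳 𝒴 : PMM) (h𝒳 : 𝒳.BoundedlyCompact) (h𝒴 : 𝒴.BoundedlyCompact) :
    (0 < GHP 𝒳 𝒴 →
      GHP 𝒳 𝒴 / 2 ≤ max (aEps (GHP 𝒳 𝒴) 𝒳 𝒴) (aEps (GHP 𝒳 𝒴) 𝒴 𝒳)) ∧
    (∀ γ : ℝ, GHP 𝒳 𝒴 < γ → γ ≤ 1 →
      max (aEps γ 𝒳 𝒴) (aEps γ 𝒴 𝒳) < γ / 2) := by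
  have hbdd : BddBelow (insert 1 {ε : ℝ | ε ∈ Set.Ioc (0 : ℝ) 1 ∧
      max (aEps ε 𝒳 𝒴) (aEps ε 𝒴 𝒳) < ε / 2}) := by
    refine ⟨0, ?_⟩
    rintro x (rfl | hx)
    exacts [zero_le_one, hx.1.1.le]
  constructor
  · intro hpos
    by_contra! hlt
    have hle1 : GHP 𝒳 𝒴 ≤ 1 := csInf_le hbdd (Set.mem_insert _ _)
    obtain ⟨a1, a2⟩ := max_lt_iff.1 hlt
    have e1 := aEps_left h𝒳 h𝒴 hpos hle1 a1
    have e2 := aEps_left h𝒴 h𝒳 hpos hle1 a2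
    obtain ⟨ε, b1, b2, b3⟩ := (e1.and (e2.and (Ioo_mem_nhdsLT hpos))).exists
    have : GHP 𝒳 𝒴 ≤ ε := csInf_le hbdd
      (Set.mem_insert_of_mem _ ⟨⟨b3.1, b3.2.le.trans hle1⟩, max_lt b1 b2⟩)
    exact absurd b3.2 (not_lt.2 this)
  · intro γ hγ hγ1
    obtain ⟨ε, hε, hεγ⟩ := exists_lt_of_csInf_lt (Set.insert_nonempty _ _) hγ
    rcases hε with rfl | ⟨hε, hlt⟩
    · exact absurd hεγ (not_lt.2 hγ1)
    · obtain ⟨a1, a2⟩ := max_lt_iff.1 hlt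
      exact max_lt (aEps_mono h𝒳 h𝒴 hε.1 hεγ hγ1 a1) (aEps_mono h𝒴 h𝒳 hε.1 hεγ hγ1 a2)

end
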